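/- In the exterior Dirichlet setting, let L > max_{∂K}(u₀ − |x|) and u̅ := |x| + L. Then for every R > 4R₀ one has u̲ ≤ u^R ≤ u̅ on B_R∖int K; for R₁ < R₂ one has u^{R₁} ≤ u^{R₂} on B_{R₁}∖int K; and as R → ∞ the functions u^R converge locally uniformly on ℝⁿ∖int K to a continuous convex function. -/

import Mathlib

open Metric Set Filter
open scoped Topology RealInnerProductSpace

noncomputable section

abbrev Euc (n : ℕ) : Type := EuclideanSpace ℝ (Fin n)

/-- The Hessian matrix of `u` at `x`, `(u_{ij})`. -/
noncomputable def Hess {n : ℕ} (u : Euc n → ℝ) (x : Euc n) : Matrix (Fin n) (Fin n) ℝ :=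
  fun i j => iteratedFDeriv ℝ 2 u x ![EuclideanSpace.single i 1, EuclideanSpace.single j 1]

/-- The Gauß curvature operator `K[u] = det D²u / (1+|Du|²)^((n+2)/2)`. -/
noncomputable def gaussK {n : ℕ} (u : Euc n → ℝ) (x : Euc n) : ℝ :=
  (Hess u x).det / (1 + ‖fderiv ℝ u x‖ ^ 2) ^ (((n : ℝ) + 2) / 2)

/-- Partial derivative `w_i` relative to a set `S`. -/
noncomputable def pdW {n : ℕ} (S : Set (Euc n)) (w : Euc n → ℝ) (x : Euc n) (i : Fin n) : ℝ :=
  fderivWithin ℝ w S x (EuclideanSpace.single i 1)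

/-- The Hessian matrix `(w_{ij})` relative to a set `S`. -/
noncomputable def HessW {n : ℕ} (S : Set (Euc n)) (w : Euc n → ℝ) (x : Euc n) :
    Matrix (Fin n) (Fin n) ℝ :=
  fun i j => iteratedFDerivWithin ℝ 2 w S x
    ![EuclideanSpace.single i 1, EuclideanSpace.single j 1]

/-- The exterior Dirichlet setting of Finster–Schnürer. -/
structure ExtSetting (n : ℕ) where
  K : Set (Euc n)
  f : Euc n → ℝ → ℝ
  u₀ : Euc n → ℝ
  ul : Euc n → ℝ
  R₀ : ℝ
  hn : 2 ≤ n
  hR₀ : 0 < R₀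
  hKne : K.Nonempty
  hKc : IsCompact K
  hK0 : 0 ∈ interior K
  hKsm : ∃ g : Euc n → ℝ, ContDiff ℝ (⊤ : ℕ∞) g ∧ K = {x | g x ≤ 0} ∧
    ∀ x ∈ frontier K, fderiv ℝ g x ≠ 0
  hKR₀ : K ⊆ ball 0 R₀
  hfsm : ContDiffOn ℝ (⊤ : ℕ∞) (fun p : Euc n × ℝ => f p.1 p.2) ((interior K)ᶜ ×ˢ univ)
  hfpos : ∀ x ∈ (interior K)ᶜ, ∀ z : ℝ, 0 < f x z
  hfz : ∀ x ∈ (interior K)ᶜ, Monotone (f x)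
  hfdec : ∃ C : ℝ, ∀ x ∈ (interior K)ᶜ, ∀ z : ℝ, f x z * ‖x‖ ^ (n + 1) ≤ C
  hfder : ∃ C : ℝ, ∀ p ∈ (interior K)ᶜ ×ˢ (univ : Set ℝ),
    ‖fderivWithin ℝ (fun q : Euc n × ℝ => f q.1 q.2) ((interior K)ᶜ ×ˢ univ) p‖ +
      ‖iteratedFDerivWithin ℝ 2 (fun q : Euc n × ℝ => f q.1 q.2) ((interior K)ᶜ ×ˢ univ) p‖
        ≤ C * f p.1 p.2
  hulsm : ContDiffOn ℝ (⊤ : ℕ∞) ul (interior K)ᶜ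
  hulconv : ∀ x ∈ Kᶜ, (Hess ul x).PosDef
  hulsub : ∀ x ∈ Kᶜ, f x (ul x) ≤ gaussK ul x
  hulbc : ∀ x ∈ frontier K, ul x = u₀ x
  hulcone : ∃ C : ℝ, ∀ x ∈ (interior K)ᶜ, |ul x - ‖x‖| ≤ C
  huldec1 : ∃ C R₁ : ℝ, ∀ x : Euc n, R₁ ≤ ‖x‖ →
    ‖fderiv ℝ (fun y => ul y - ‖y‖) x‖ ≤ C / ‖x‖
  huldec2 : ∃ C R₁ : ℝ, ∀ x : Euc n, R₁ ≤ ‖x‖ →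
    ‖iteratedFDeriv ℝ 2 (fun y => ul y - ‖y‖) x‖ + ‖iteratedFDeriv ℝ 3 ul x‖ ≤ C / ‖x‖ ^ 2

/-- The domain `B_R ∖ int K` of the compact Dirichlet problem. -/
def solDom {n : ℕ} (S : ExtSetting n) (R : ℝ) : Set (Euc n) :=
  closedBall 0 R \ interior S.K

/-- `u` is a smooth strictly convex solution `u^R` of the compact Dirichlet problem
`K[u^R] = f(x,u^R)` in `B_R ∖ K`, `u^R = u̲` on `∂B_R ∪ ∂K`. -/
def IsSol {n : ℕ} (S : ExtSetting n) (R : ℝ) (u : Euc n → ℝ) : Prop :=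
  ContDiffOn ℝ (⊤ : ℕ∞) u (solDom S R) ∧
  (∀ x ∈ ball 0 R \ S.K, (Hess u x).PosDef) ∧
  (∀ x ∈ ball 0 R \ S.K, gaussK u x = S.f x (u x)) ∧
  (∀ x ∈ sphere (0 : Euc n) R ∪ frontier S.K, u x = S.ul x)

section Auxiliary

open Matrix

theorem Matrix.det_add_vecMulVec {n : ℕ} (A : Matrix (Fin n) (Fin n) ℝ) (hA : IsUnit A.det)
    (v : Fin n → ℝ) : (A + vecMulVec v v).det = A.det * (1 + v ⬝ᵥ (A⁻¹ *ᵥ v)) := by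
  have h := det_add_replicateCol_mul_replicateRow (ι := Unit) hA v v
  rw [vecMulVec_eq Unit, h, det_unique (n := Unit), Matrix.add_apply, Matrix.one_apply_eq,
    Matrix.mul_assoc, ← replicateCol_mulVec, Matrix.replicateRow_mul_replicateCol_apply]

theorem Matrix.PosDef.det_le_det_add_vecMulVec {n : ℕ} {A : Matrix (Fin n) (Fin n) ℝ}
    (hA : A.PosDef) (v : Fin n → ℝ) : A.det ≤ (A + vecMulVec v v).det := by
  rw [Matrix.det_add_vecMulVec A hA.det_pos.ne'.isUnit]
  have := hA.inv.posSemidef.dotProduct_mulVec_nonneg v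
  simp only [star_trivial] at this
  nlinarith [hA.det_pos]

theorem Matrix.PosDef.det_le_det_add {n : ℕ} {A P : Matrix (Fin n) (Fin n) ℝ}
    (hA : A.PosDef) (hP : P.PosSemidef) : A.det ≤ (A + P).det := by
  obtain ⟨m, v, rfl⟩ := posSemidef_iff_eq_sum_vecMulVec.1 hP
  simp only [star_trivial]
  have key : ∀ s : Finset (Fin m), (A + ∑ k ∈ s, vecMulVec (v k) (v k)).PosDef ∧
      A.det ≤ (A + ∑ k ∈ s, vecMulVec (v k) (v k)).det := by
    intro s
    induction s using Finset.induction_on with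
    | empty => simp [hA]
    | insert a s ha ih =>
      rw [Finset.sum_insert ha, add_comm (vecMulVec _ _), ← add_assoc]
      exact ⟨ih.1.add_posSemidef (by simpa using posSemidef_vecMulVec_self_star (v a)),
        ih.2.trans (ih.1.det_le_det_add_vecMulVec (v a))⟩
  exact (key Finset.univ).2

theorem Matrix.PosDef.inv_diag_le_diag_inv {n : ℕ} {B : Matrix (Fin n) (Fin n) ℝ}
    (hB : B.PosDef) (i : Fin n) : (B i i)⁻¹ ≤ B⁻¹ i i := by
  have hb : 0 < B i i := hB.diag_pos
  have hu : IsUnit B.det := hB.det_pos.ne'.isUnit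
  have h := hB.posSemidef.dotProduct_mulVec_nonneg
    (B⁻¹ *ᵥ Pi.single i 1 - (B i i)⁻¹ • Pi.single i 1)
  have hsym : ∀ k l, B⁻¹ k l = B⁻¹ l k := fun k l => by
    simpa using hB.inv.isHermitian.apply l k
  have e1 : B *ᵥ (B⁻¹ *ᵥ Pi.single i 1 - (B i i)⁻¹ • Pi.single i 1)
      = Pi.single i 1 - (B i i)⁻¹ • B.col i := by
    rw [mulVec_sub, mulVec_mulVec, Matrix.mul_nonsing_inv _ hu, one_mulVec, mulVec_smul]
    simp
  rw [e1, star_trivial, sub_dotProduct, dotProduct_sub, dotProduct_sub] at h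
  have e2 : (B⁻¹ *ᵥ Pi.single i 1) ⬝ᵥ B.col i = 1 := by
    have := congrFun (congrFun (Matrix.nonsing_inv_mul B hu) i) i
    simp only [Matrix.mul_apply, Matrix.one_apply_eq] at this
    simp only [mulVec_single_one, dotProduct, Matrix.col_apply]
    rw [← this]
    exact Finset.sum_congr rfl fun k _ => by rw [hsym]
  rw [dotProduct_smul, e2] at h
  simp at h
  field_simp at h ⊢
  linarith

theorem Matrix.PosDef.det_mul_le_det {n : ℕ} {A B : Matrix (Fin n) (Fin n) ℝ}
    (hA : A.IsHermitian) (hB : B.PosDef) (i : Fin n) {t : ℝ} (ht : 0 ≤ t)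
    (h : ∀ a : Fin n → ℝ, a ⬝ᵥ (B *ᵥ a) + t * a i ^ 2 ≤ a ⬝ᵥ (A *ᵥ a)) :
    B.det * (1 + t / B i i) ≤ A.det := by
  set v : Fin n → ℝ := Pi.single i (√t) with hv
  have hC : (B + vecMulVec v v).PosDef :=
    hB.add_posSemidef (by simpa using posSemidef_vecMulVec_self_star v)
  have hP : (A - (B + vecMulVec v v)).PosSemidef := by
    refine .of_dotProduct_mulVec_nonneg (hA.sub hC.isHermitian) fun a => ?_
    have h1 : a ⬝ᵥ (vecMulVec v v *ᵥ a) = t * a i ^ 2 := by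
      rw [vecMulVec_mulVec]
      simp [hv]
      linear_combination a i ^ 2 * Real.mul_self_sqrt ht
    rw [star_trivial, sub_mulVec, add_mulVec, dotProduct_sub, dotProduct_add, h1]
    linarith [h a]
  have h2 := hC.det_le_det_add hP
  rw [add_sub_cancel] at h2
  refine le_trans ?_ h2
  rw [Matrix.det_add_vecMulVec B hB.det_pos.ne'.isUnit]
  have h3 : v ⬝ᵥ (B⁻¹ *ᵥ v) = t * B⁻¹ i i := by
    simp [hv]
    linear_combination B⁻¹ i i * Real.mul_self_sqrt ht
  rw [h3, div_eq_mul_inv]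
  have := hB.inv_diag_le_diag_inv i
  have := hB.det_pos
  gcongr

theorem IsLocalMax.deriv_eq_zero_and_deriv_deriv_nonpos {h h₁ : ℝ → ℝ} {c : ℝ}
    (hd : ∀ᶠ t in 𝓝 (0 : ℝ), HasDerivAt h (h₁ t) t) (hc : HasDerivAt h₁ c 0)
    (hm : IsLocalMax h 0) : h₁ 0 = 0 ∧ c ≤ 0 := by
  have h0 : HasDerivAt h (h₁ 0) 0 := hd.self_of_nhds
  have hz : h₁ 0 = 0 := hm.hasDerivAt_eq_zero h0
  refine ⟨hz, not_lt.1 fun hcpos => ?_⟩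
  have he : deriv h =ᶠ[𝓝 0] h₁ := hd.mono fun t ht => ht.deriv
  have hmin : IsLocalMin h 0 := isLocalMin_of_deriv_deriv_pos
    (by rw [he.deriv_eq, hc.deriv]; exact hcpos) (h0.deriv.trans hz) h0.continuousAt
  have hconst : h =ᶠ[𝓝 0] fun _ => h 0 := by
    filter_upwards [hm, hmin] with t h1 h2 using le_antisymm h1 h2
  have hdd : deriv (deriv h) 0 = 0 := by
    rw [hconst.deriv.deriv_eq]
    simp
  rw [he.deriv_eq, hc.deriv] at hdd
  exact hcpos.ne' hdd

section Lines

variable {E : Type*} [NormedAddCommGroup E] [NormedSpace ℝ E] {u : E → ℝ} {x : E}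

theorem ContDiffAt.hasDerivAt_line {t : ℝ} {a : E} (hu : ContDiffAt ℝ 2 u (x + t • a)) :
    HasDerivAt (fun t : ℝ => u (x + t • a)) (fderiv ℝ u (x + t • a) a) t := by
  have hl : HasDerivAt (fun t : ℝ => x + t • a) a t := by
    simpa using ((hasDerivAt_id t).smul_const a).const_add x
  exact (hu.differentiableAt (by norm_num)).hasFDerivAt.comp_hasDerivAt t hl

theorem ContDiffAt.hasDerivAt_fderiv_line {t : ℝ} {a : E} (hu : ContDiffAt ℝ 2 u (x + t • a)) :
    HasDerivAt (fun t : ℝ => fderiv ℝ u (x + t • a) a)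
      (fderiv ℝ (fderiv ℝ u) (x + t • a) a a) t := by
  have hl : HasDerivAt (fun t : ℝ => x + t • a) a t := by
    simpa using ((hasDerivAt_id t).smul_const a).const_add x
  have h1 : ContDiffAt ℝ 1 (fderiv ℝ u) (x + t • a) := hu.fderiv_right (by norm_num)
  have := (h1.differentiableAt (by norm_num)).hasFDerivAt.comp_hasDerivAt t hl
  simpa using this.clm_apply (hasDerivAt_const t a)

theorem ContDiffAt.eventually_hasDerivAt_line (hu : ContDiffAt ℝ 2 u x) (a : E) :
    ∀ᶠ t in 𝓝 (0 : ℝ), HasDerivAt (fun t : ℝ => u (x + t • a)) (fderiv ℝ u (x + t • a) a) t := by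
  have hl : Tendsto (fun t : ℝ => x + t • a) (𝓝 0) (𝓝 x) := by
    have : Continuous fun t : ℝ => x + t • a := by fun_prop
    simpa using this.tendsto 0
  exact (hl.eventually (hu.eventually (by simp))).mono fun t ht => ht.hasDerivAt_line

end Lines

theorem fderiv_fderiv_apply_eq_Hess {n : ℕ} (u : Euc n → ℝ) (x a : Euc n) :
    fderiv ℝ (fderiv ℝ u) x a a = a.ofLp ⬝ᵥ (Hess u x *ᵥ a.ofLp) := by
  have ha : a = ∑ i, a i • EuclideanSpace.single i (1 : ℝ) := by
    ext j
    simp [Pi.single_apply]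
  have hH : ∀ i j, Hess u x i j = fderiv ℝ (fderiv ℝ u) x (EuclideanSpace.single i 1)
      (EuclideanSpace.single j 1) := fun i j => by
    simp [Hess, iteratedFDeriv_two_apply]
  conv_lhs => rw [ha]
  simp only [map_sum, map_smul, _root_.sum_apply, _root_.smul_apply,
    smul_eq_mul, dotProduct, mulVec, hH, Finset.mul_sum]
  rw [Finset.sum_comm]
  exact Finset.sum_congr rfl fun i _ => Finset.sum_congr rfl fun j _ => by ring

theorem one_add_pow_le_one_add_two_pow_mul {δ : ℝ} (h0 : 0 ≤ δ) (h1 : δ ≤ 1) (k : ℕ) :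
    (1 + δ) ^ k ≤ 1 + (2 ^ k - 1) * δ := by
  induction k with
  | zero => simp
  | succ k ih =>
    have h2 : (1 : ℝ) ≤ 2 ^ k := one_le_pow₀ (by norm_num)
    have h3 : 0 ≤ ((2 : ℝ) ^ k - 1) * (δ * (1 - δ)) := by
      have := sub_nonneg.2 h1
      have := sub_nonneg.2 h2
      positivity
    rw [pow_succ, pow_succ]
    nlinarith [mul_le_mul_of_nonneg_right ih (by linarith : 0 ≤ 1 + δ)]

/-- The gradient term of the curvature operator grows at most polynomially under a small
perturbation of the gradient. -/
theorem one_add_sq_rpow_le {n : ℕ} {p q δ : ℝ} (hp : 0 ≤ p) (hδ : 0 ≤ δ) (h : p ≤ q + δ) :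
    (1 + p ^ 2) ^ (((n : ℝ) + 2) / 2) ≤
      (1 + q ^ 2) ^ (((n : ℝ) + 2) / 2) * (1 + δ) ^ (n + 2) := by
  have h1 : 1 + p ^ 2 ≤ (1 + q ^ 2) * (1 + δ) ^ 2 := by
    nlinarith [mul_nonneg hδ (sq_nonneg (q - 1)), mul_nonneg (sq_nonneg δ) (sq_nonneg q),
      mul_nonneg hδ (sq_nonneg q)]
  have h2 : ((1 + δ) ^ 2) ^ (((n : ℝ) + 2) / 2) = (1 + δ) ^ (n + 2) := by
    rw [← Real.rpow_natCast, ← Real.rpow_mul (by positivity), ← Real.rpow_natCast]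
    congr 1
    push_cast
    ring
  rw [← h2, ← Real.mul_rpow (by positivity) (by positivity)]
  exact Real.rpow_le_rpow (by positivity) h1 (by positivity)

/-- At a local maximum of `w - u`, perturbed by a steep exponential, the curvature of `w` is
strictly less than that of `u`. -/
theorem gaussK_lt_of_isLocalMax {n : ℕ} (i : Fin n) {u w : Euc n → ℝ} {x : Euc n} {M lam ε : ℝ}
    (hu : ContDiffAt ℝ 2 u x) (hw : ContDiffAt ℝ 2 w x)
    (hA : (Hess u x).PosDef) (hB : (Hess w x).PosDef)
    (hM : Hess w x i i ≤ M) (hlam : lam = M * 2 ^ (n + 2)) (hε : 0 < ε)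
    (hε1 : ε * lam * Real.exp (lam * x i) ≤ 1)
    (hmax : IsLocalMax (fun y => w y - u y + ε * Real.exp (lam * y i)) x) :
    gaussK w x < gaussK u x := by
  have hb : 0 < Hess w x i i := hB.diag_pos
  have hM0 : 0 < M := hb.trans_le hM
  have hlam0 : 0 < lam := by rw [hlam]; positivity
  set δ : ℝ := ε * lam * Real.exp (lam * x i) with hδ
  have hδ0 : 0 < δ := by positivity
  have key : ∀ a : Euc n, fderiv ℝ w x a - fderiv ℝ u x a + δ * a i = 0 ∧
      fderiv ℝ (fderiv ℝ w) x a a - fderiv ℝ (fderiv ℝ u) x a a + δ * lam * a i ^ 2 ≤ 0 := by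
    intro a
    have hx0 : x + (0 : ℝ) • a = x := by simp
    have hlin : ∀ t : ℝ, HasDerivAt (fun t : ℝ => lam * (x + t • a) i) (lam * a i) t := by
      intro t
      simp only [PiLp.add_apply, PiLp.smul_apply, smul_eq_mul]
      simpa using (((hasDerivAt_id t).mul_const (a i)).const_add (x i)).const_mul lam
    have h1 : ∀ᶠ t in 𝓝 (0 : ℝ),
        HasDerivAt (fun t : ℝ => w (x + t • a) - u (x + t • a)
          + ε * Real.exp (lam * (x + t • a) i))
        (fderiv ℝ w (x + t • a) a - fderiv ℝ u (x + t • a) a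
          + ε * (Real.exp (lam * (x + t • a) i) * (lam * a i))) t := by
      filter_upwards [hu.eventually_hasDerivAt_line a, hw.eventually_hasDerivAt_line a]
        with t h1 h2
      exact (h2.sub h1).add ((hlin t).exp.const_mul ε)
    have h2 : HasDerivAt (fun t : ℝ => fderiv ℝ w (x + t • a) a - fderiv ℝ u (x + t • a) a
          + ε * (Real.exp (lam * (x + t • a) i) * (lam * a i)))
        (fderiv ℝ (fderiv ℝ w) x a a - fderiv ℝ (fderiv ℝ u) x a a
          + ε * (Real.exp (lam * (x + (0 : ℝ) • a) i) * (lam * a i) * (lam * a i))) 0 := by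
      have h3 := ContDiffAt.hasDerivAt_fderiv_line (t := 0) (a := a) (hx0.symm ▸ hw)
      have h4 := ContDiffAt.hasDerivAt_fderiv_line (t := 0) (a := a) (hx0.symm ▸ hu)
      rw [hx0] at h3 h4
      exact (h3.sub h4).add (((hlin 0).exp.mul_const (lam * a i)).const_mul ε)
    have h3 : IsLocalMax (fun t : ℝ => w (x + t • a) - u (x + t • a)
          + ε * Real.exp (lam * (x + t • a) i)) 0 := by
      have hl : ContinuousAt (fun t : ℝ => x + t • a) 0 := by fun_prop
      rw [← hx0] at hmax
      exact IsLocalMax.comp_continuous (g := fun t : ℝ => x + t • a) hmax hl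
    have h4 := h3.deriv_eq_zero_and_deriv_deriv_nonpos h1 h2
    rw [hx0] at h4
    refine ⟨?_, ?_⟩
    · rw [← h4.1, hδ]; ring
    · refine le_trans (le_of_eq ?_) h4.2
      rw [hδ]; ring
  have hgrad : ‖fderiv ℝ u x‖ ≤ ‖fderiv ℝ w x‖ + δ := by
    refine ContinuousLinearMap.opNorm_le_bound _ (by positivity) fun a => ?_
    have h1 : fderiv ℝ u x a = fderiv ℝ w x a + δ * a i := by linarith [(key a).1]
    rw [h1, add_mul]
    refine (norm_add_le _ _).trans (add_le_add (ContinuousLinearMap.le_opNorm _ _) ?_)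
    rw [norm_mul, Real.norm_of_nonneg hδ0.le]
    exact mul_le_mul_of_nonneg_left (PiLp.norm_apply_le a i) hδ0.le
  have hdet := Matrix.PosDef.det_mul_le_det hA.isHermitian hB i (t := δ * lam) (by positivity)
    fun a => by
      have h1 := (key (WithLp.toLp 2 a)).2
      rw [fderiv_fderiv_apply_eq_Hess, fderiv_fderiv_apply_eq_Hess] at h1
      simp only at h1
      linarith
  have ht : δ * 2 ^ (n + 2) ≤ δ * lam / Hess w x i i := by
    rw [le_div_iff₀ hb, hlam, mul_assoc, mul_comm M]
    gcongr
  have hrp := one_add_sq_rpow_le (n := n) (norm_nonneg (fderiv ℝ u x)) hδ0.le hgrad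
  have hpow := one_add_pow_le_one_add_two_pow_mul hδ0.le hε1 (n + 2)
  unfold gaussK
  set P : ℝ := (1 + ‖fderiv ℝ u x‖ ^ 2) ^ (((n : ℝ) + 2) / 2)
  set Q : ℝ := (1 + ‖fderiv ℝ w x‖ ^ 2) ^ (((n : ℝ) + 2) / 2)
  have hP : 0 < P := by positivity
  have hQ : 0 < Q := by positivity
  have hD := hB.det_pos
  rw [div_lt_div_iff₀ hQ hP]
  calc (Hess w x).det * P ≤ (Hess w x).det * (Q * (1 + δ) ^ (n + 2)) := by gcongr
    _ < (Hess w x).det * (Q * (1 + δ * lam / Hess w x i i)) := by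
      gcongr
      linarith
    _ = ((Hess w x).det * (1 + δ * lam / Hess w x i i)) * Q := by ring
    _ ≤ (Hess u x).det * Q := by gcongr

theorem continuousAt_Hess_apply {n : ℕ} {u : Euc n → ℝ} {x : Euc n} (hu : ContDiffAt ℝ 2 u x)
    (i j : Fin n) : ContinuousAt (fun y => Hess u y i j) x := by
  have h1 : ContDiffAt ℝ 0 (fderiv ℝ (fderiv ℝ u)) x :=
    (hu.fderiv_right (m := 1) (by norm_num)).fderiv_right (by norm_num)
  have h2 := h1.continuousAt
  have : (fun y => Hess u y i j) = fun y => fderiv ℝ (fderiv ℝ u) y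
      (EuclideanSpace.single i 1) (EuclideanSpace.single j 1) := by
    ext y
    simp [Hess, iteratedFDeriv_two_apply]
  rw [this]
  fun_prop

/-- Comparison principle for strictly convex functions and the Gauss curvature operator. -/
theorem le_of_gaussK_le {n : ℕ} (i : Fin n) {Ω : Set (Euc n)} (hΩ : IsOpen Ω)
    (hb : Bornology.IsBounded Ω) {u w : Euc n → ℝ}
    (huc : ContinuousOn u (closure Ω)) (hwc : ContinuousOn w (closure Ω))
    (hu : ∀ x ∈ Ω, ContDiffAt ℝ 2 u x) (hw : ∀ x ∈ Ω, ContDiffAt ℝ 2 w x)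
    (hup : ∀ x ∈ Ω, (Hess u x).PosDef) (hwp : ∀ x ∈ Ω, (Hess w x).PosDef)
    (hK : ∀ x ∈ Ω, u x < w x → gaussK u x ≤ gaussK w x)
    (hbd : ∀ x ∈ frontier Ω, w x ≤ u x) : ∀ x ∈ closure Ω, w x ≤ u x := by
  by_contra! hcon
  obtain ⟨z, hz, hzlt⟩ := hcon
  set m : ℝ := w z - u z with hm
  have hm0 : 0 < m := sub_pos.2 hzlt
  have hcpt : IsCompact (closure Ω) := hb.isCompact_closure
  set C : Set (Euc n) := closure Ω ∩ (fun x => w x - u x) ⁻¹' Ici (m / 2) with hC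
  have hCcpt : IsCompact C := hcpt.of_isClosed_subset
    ((hwc.sub huc).preimage_isClosed_of_isClosed isClosed_closure isClosed_Ici)
    inter_subset_left
  have hCΩ : C ⊆ Ω := by
    intro x hx
    by_contra hxΩ
    have h1 := hbd x ⟨hx.1, by rwa [hΩ.interior_eq]⟩
    have h2 : m / 2 ≤ w x - u x := hx.2
    linarith
  obtain ⟨M, hM⟩ := (hCcpt.bddAbove_image (f := fun x => Hess w x i i) fun x hx =>
    (continuousAt_Hess_apply (hw x (hCΩ hx)) i i).continuousWithinAt)
  have hM' : ∀ x ∈ C, Hess w x i i ≤ max M 1 := fun x hx =>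
    (hM (mem_image_of_mem _ hx)).trans (le_max_left _ _)
  set lam : ℝ := max M 1 * 2 ^ (n + 2) with hlam
  have hlam0 : 0 < lam := by positivity
  have hexpc : Continuous fun x : Euc n => Real.exp (lam * x i) := by fun_prop
  obtain ⟨E, hE⟩ := hcpt.bddAbove_image hexpc.continuousOn
  have hE' : ∀ x ∈ closure Ω, Real.exp (lam * x i) ≤ E := fun x hx => hE (mem_image_of_mem _ hx)
  have hE0 : 0 < E := (Real.exp_pos _).trans_le (hE' z hz)
  set ε : ℝ := min (1 / (lam * E)) (m / (2 * E)) with hε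
  have hε0 : 0 < ε := by positivity
  have hε1 : ε * (lam * E) ≤ 1 := by
    rw [← le_div_iff₀ (by positivity)]
    exact min_le_left _ _
  have hε2 : ε * E ≤ m / 2 := by
    rw [← le_div_iff₀ hE0, div_div]
    exact min_le_right _ _
  obtain ⟨x, hx, hxmax⟩ := hcpt.exists_isMaxOn ⟨z, hz⟩
    ((hwc.sub huc).add (hexpc.continuousOn.const_mul ε))
  have hxC : x ∈ C := by
    refine ⟨hx, ?_⟩
    have h1 : w z - u z + ε * Real.exp (lam * z i) ≤ w x - u x + ε * Real.exp (lam * x i) :=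
      hxmax hz
    have h2 : ε * Real.exp (lam * x i) ≤ ε * E := by gcongr; exact hE' x hx
    have h3 : 0 < ε * Real.exp (lam * z i) := by positivity
    change m / 2 ≤ w x - u x
    linarith
  have hxΩ := hCΩ hxC
  have hlt := gaussK_lt_of_isLocalMax i (hu x hxΩ) (hw x hxΩ) (hup x hxΩ) (hwp x hxΩ)
    (hM' x hxC) hlam hε0
    (le_trans (by rw [mul_assoc]; gcongr; exact hE' x hx) hε1)
    ((hxmax.on_subset subset_closure).isLocalMax (hΩ.mem_nhds hxΩ))
  have h2 : m / 2 ≤ w x - u x := hxC.2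
  exact absurd (hK x hxΩ (by linarith)) (not_le.2 hlt)

theorem two_le_natTop : (2 : WithTop ℕ∞) ≤ ((⊤ : ℕ∞) : WithTop ℕ∞) :=
  WithTop.coe_le_coe.2 (le_top : (2 : ℕ∞) ≤ ⊤)

/-- A continuous function on `[0, 1]` satisfying the midpoint inequality at small scales lies
below its chord. -/
theorem le_chord_of_local_midpoint {h : ℝ → ℝ} (hc : ContinuousOn h (Icc 0 1))
    (hmid : ∀ t ∈ Ioo (0 : ℝ) 1, ∃ δ₀ > 0, ∀ δ ∈ Ioo 0 δ₀, 2 * h t ≤ h (t - δ) + h (t + δ)) :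
    ∀ t ∈ Icc (0 : ℝ) 1, h t ≤ (1 - t) * h 0 + t * h 1 := by
  set k : ℝ → ℝ := fun t => h t - ((1 - t) * h 0 + t * h 1) with hk
  have hkc : ContinuousOn k (Icc 0 1) := hc.sub (by fun_prop)
  obtain ⟨z, hz, hzmax⟩ := isCompact_Icc.exists_isMaxOn ⟨0, by simp⟩ hkc
  suffices hle : k z ≤ 0 by
    intro t ht
    have h1 : k t ≤ k z := hzmax ht
    simp only [hk] at h1 hle
    linarith
  by_contra! hpos
  have hT : IsCompact (Icc (0 : ℝ) 1 ∩ k ⁻¹' {k z}) :=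
    isCompact_Icc.of_isClosed_subset
      (hkc.preimage_isClosed_of_isClosed isClosed_Icc isClosed_singleton) inter_subset_left
  obtain ⟨t, ⟨ht, htz⟩, hleast⟩ := hT.exists_isLeast ⟨z, hz, rfl⟩
  have htz : k t = k z := htz
  have ht0 : 0 < t := ht.1.lt_of_ne fun h0 => by
    rw [← htz, ← h0] at hpos
    simp [hk] at hpos
  have ht1 : t < 1 := ht.2.lt_of_ne fun h0 => by
    rw [← htz, h0] at hpos
    simp [hk] at hpos
  obtain ⟨δ₀, hδ₀, hδ⟩ := hmid t ⟨ht0, ht1⟩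
  obtain ⟨δ, hδ0, hδlt⟩ := exists_between (lt_min hδ₀ (lt_min ht0 (sub_pos.2 ht1)))
  obtain ⟨hlt₀, hlt₁, hlt₂⟩ := by simpa only [lt_min_iff] using hδlt
  have hm := hδ δ ⟨hδ0, hlt₀⟩
  have hmem : t - δ ∈ Icc (0 : ℝ) 1 := ⟨by linarith, by linarith⟩
  have h1 : k (t - δ) < k z := (hzmax hmem).lt_of_ne fun h0 => by
    have : t ≤ t - δ := hleast ⟨hmem, h0⟩
    linarith
  have h2 : k (t + δ) ≤ k z := hzmax ⟨by linarith, by linarith⟩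
  rw [← htz] at h1 h2
  simp only [hk] at h1 h2
  linarith

theorem convexOn_line_of_Hess_posSemidef {n : ℕ} {u : Euc n → ℝ} {x d : Euc n}
    (hc : ContinuousOn (fun t : ℝ => u (x + t • d)) (Icc 0 1))
    (hu : ∀ t ∈ Ioo (0 : ℝ) 1, ContDiffAt ℝ 2 u (x + t • d))
    (hp : ∀ t ∈ Ioo (0 : ℝ) 1, (Hess u (x + t • d)).PosSemidef) :
    ConvexOn ℝ (Icc 0 1) (fun t : ℝ => u (x + t • d)) := by
  have hderiv : ∀ t ∈ Ioo (0 : ℝ) 1, deriv (fun t : ℝ => u (x + t • d)) =ᶠ[𝓝 t]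
      fun t => fderiv ℝ u (x + t • d) d := fun t ht => by
    filter_upwards [isOpen_Ioo.mem_nhds ht] with s hs using (hu s hs).hasDerivAt_line.deriv
  refine convexOn_of_deriv2_nonneg (convex_Icc 0 1) hc ?_ ?_ ?_ <;> rw [interior_Icc]
  · exact fun t ht => (hu t ht).hasDerivAt_line.differentiableAt.differentiableWithinAt
  · exact fun t ht => ((hu t ht).hasDerivAt_fderiv_line.differentiableAt.congr_of_eventuallyEq
      (hderiv t ht)).differentiableWithinAt
  · intro t ht
    simp only [Function.iterate_succ, Function.iterate_zero, Function.comp_apply, id]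
    rw [(hderiv t ht).deriv_eq, (hu t ht).hasDerivAt_fderiv_line.deriv,
      fderiv_fderiv_apply_eq_Hess]
    simpa using (hp t ht).dotProduct_mulVec_nonneg d.ofLp

/-- A strictly convex function minus a multiple of the norm has no interior local maximum away
from the origin. -/
theorem not_isLocalMax_sub_norm {n : ℕ} {w : Euc n → ℝ} {x : Euc n} (hx : x ≠ 0) (c : ℝ)
    (hw : ContDiffAt ℝ 2 w x) (hp : (Hess w x).PosDef) :
    ¬ IsLocalMax (fun y => w y - c * ‖y‖) x := by
  intro hmax
  have hx0 : x + (0 : ℝ) • x = x := by simp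
  have hl : ContinuousAt (fun t : ℝ => x + t • x) 0 := by fun_prop
  have h1 : IsLocalMax (fun t : ℝ => w (x + t • x) - c * ‖x + t • x‖) 0 := by
    rw [← hx0] at hmax
    exact IsLocalMax.comp_continuous (g := fun t : ℝ => x + t • x) hmax hl
  have h2 : ∀ᶠ t in 𝓝 (0 : ℝ), HasDerivAt (fun t : ℝ => w (x + t • x) - c * ‖x + t • x‖)
      (fderiv ℝ w (x + t • x) x - c * ‖x‖) t := by
    filter_upwards [hw.eventually_hasDerivAt_line x, Ioi_mem_nhds (show (-1 : ℝ) < 0 by norm_num)]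
      with t h3 ht
    have h4 : HasDerivAt (fun t : ℝ => c * ((1 + t) * ‖x‖)) (c * ‖x‖) t := by
      simpa using (((hasDerivAt_id t).const_add 1).mul_const ‖x‖).const_mul c
    refine (h3.sub h4).congr_of_eventuallyEq ?_
    filter_upwards [Ioi_mem_nhds ht] with s hs
    have hs' : (0 : ℝ) ≤ 1 + s := by linarith [mem_Ioi.1 hs]
    have : x + s • x = (1 + s) • x := by rw [add_smul, one_smul]
    simp only [Pi.sub_apply, sub_right_inj]
    rw [this, norm_smul, Real.norm_of_nonneg hs']
  have h3 := ContDiffAt.hasDerivAt_fderiv_line (t := 0) (a := x) (hx0.symm ▸ hw)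
  have h4 := (h1.deriv_eq_zero_and_deriv_deriv_nonpos h2 (h3.sub_const _)).2
  rw [hx0, fderiv_fderiv_apply_eq_Hess] at h4
  have h5 := hp.dotProduct_mulVec_pos (x := x.ofLp) (by simpa using hx)
  rw [star_trivial] at h5
  linarith

namespace ExtSetting

variable {n : ℕ} (S : ExtSetting n)

theorem isCompact_solDom (R : ℝ) : IsCompact (solDom S R) :=
  (isCompact_closedBall 0 R).diff isOpen_interior

theorem solDom_mem_nhds {R : ℝ} {x : Euc n} (hx : x ∈ ball 0 R \ S.K) : solDom S R ∈ 𝓝 x :=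
  mem_of_superset ((isOpen_ball.sdiff S.hKc.isClosed).mem_nhds hx)
    (sdiff_subset_sdiff ball_subset_closedBall interior_subset)

theorem mem_frontier {x : Euc n} (hx : x ∈ S.K) (hx' : x ∉ interior S.K) : x ∈ frontier S.K :=
  ⟨subset_closure hx, hx'⟩

theorem mem_ball_diff_or_boundary {R : ℝ} {x : Euc n} (hx : x ∈ solDom S R) :
    x ∈ ball 0 R \ S.K ∨ x ∈ sphere (0 : Euc n) R ∪ frontier S.K := by
  by_cases hK : x ∈ S.K
  · exact .inr (.inr (S.mem_frontier hK hx.2))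
  · rcases (mem_closedBall.1 hx.1).lt_or_eq with h | h
    · exact .inl ⟨h, hK⟩
    · exact .inr (.inl h)

theorem frontier_ball_diff_subset (R : ℝ) :
    frontier (ball 0 R \ S.K) ⊆ sphere (0 : Euc n) R ∪ frontier S.K := by
  intro x hx
  rw [sdiff_eq] at hx
  rcases frontier_inter_subset _ _ hx with h | h
  · exact .inl (frontier_ball_subset_sphere h.1)
  · exact .inr (frontier_compl S.K ▸ h.2)

theorem closure_ball_diff_subset (R : ℝ) : closure (ball 0 R \ S.K) ⊆ solDom S R :=
  closure_minimal (sdiff_subset_sdiff ball_subset_closedBall interior_subset)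
    (S.isCompact_solDom R).isClosed

theorem comparison {R : ℝ} {u w : Euc n → ℝ}
    (hu : ContDiffOn ℝ 2 u (solDom S R)) (hw : ContDiffOn ℝ 2 w (solDom S R))
    (hup : ∀ x ∈ ball 0 R \ S.K, (Hess u x).PosDef)
    (hwp : ∀ x ∈ ball 0 R \ S.K, (Hess w x).PosDef)
    (hK : ∀ x ∈ ball 0 R \ S.K, u x < w x → gaussK u x ≤ gaussK w x)
    (hbd : ∀ x ∈ sphere (0 : Euc n) R ∪ frontier S.K, w x ≤ u x) :
    ∀ x ∈ solDom S R, w x ≤ u x := by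
  intro x hx
  rcases S.mem_ball_diff_or_boundary hx with h | h
  · have hcl := S.closure_ball_diff_subset R
    exact le_of_gaussK_le (⟨0, by linarith [S.hn]⟩ : Fin n) (isOpen_ball.sdiff S.hKc.isClosed)
      (isBounded_ball.subset sdiff_subset) (hu.continuousOn.mono hcl) (hw.continuousOn.mono hcl)
      (fun y hy => hu.contDiffAt (S.solDom_mem_nhds hy))
      (fun y hy => hw.contDiffAt (S.solDom_mem_nhds hy)) hup hwp hK
      (fun y hy => hbd y (S.frontier_ball_diff_subset R hy)) x (subset_closure h)
  · exact hbd x h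

theorem le_mul_norm_add {R c L : ℝ} {w : Euc n → ℝ} (hw : ContDiffOn ℝ 2 w (solDom S R))
    (hwp : ∀ x ∈ ball 0 R \ S.K, (Hess w x).PosDef)
    (hbd : ∀ x ∈ sphere (0 : Euc n) R ∪ frontier S.K, w x ≤ c * ‖x‖ + L) :
    ∀ x ∈ solDom S R, w x ≤ c * ‖x‖ + L := by
  intro x hx
  obtain ⟨z, hz, hzmax⟩ := (S.isCompact_solDom R).exists_isMaxOn ⟨x, hx⟩
    (hw.continuousOn.sub (by fun_prop : ContinuousOn (fun y : Euc n => c * ‖y‖) (solDom S R)))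
  have hxz : w x - c * ‖x‖ ≤ w z - c * ‖z‖ := hzmax hx
  rcases S.mem_ball_diff_or_boundary hz with h | h
  · have hz0 : z ≠ 0 := by
      rintro rfl
      exact hz.2 S.hK0
    have hnhds := S.solDom_mem_nhds h
    exact absurd (hzmax.isLocalMax hnhds)
      (not_isLocalMax_sub_norm hz0 c (hw.contDiffAt hnhds) (hwp z h))
  · linarith [hbd z h]

theorem notMem_K_of_le_norm {x : Euc n} (hx : S.R₀ ≤ ‖x‖) : x ∉ S.K := fun h => by
  have := S.hKR₀ h
  rw [mem_ball_zero_iff] at this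
  linarith

theorem solDom_subset (R : ℝ) : solDom S R ⊆ (interior S.K)ᶜ := fun _ hx => hx.2

theorem ul_contDiffOn (R : ℝ) : ContDiffOn ℝ 2 S.ul (solDom S R) :=
  (S.hulsm.mono (S.solDom_subset R)).of_le two_le_natTop

variable {L : ℝ}

theorem ul_le_norm_add (hL : ∀ x ∈ frontier S.K, S.u₀ x - ‖x‖ < L) :
    ∀ x ∈ (interior S.K)ᶜ, S.ul x ≤ ‖x‖ + L := by
  intro x hx
  obtain ⟨C, hC⟩ := S.hulcone
  refine le_of_forall_pos_le_add fun η hη => ?_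
  set ε : ℝ := η / (‖x‖ + 1) with hε
  have hε0 : 0 < ε := by positivity
  set R : ℝ := max (max ‖x‖ S.R₀) ((C - L) / ε) with hR
  have hRx : ‖x‖ ≤ R := (le_max_left _ _).trans (le_max_left _ _)
  have hR0 : S.R₀ ≤ R := (le_max_right _ _).trans (le_max_left _ _)
  have hRC : C - L ≤ R * ε := (div_le_iff₀ hε0).1 (le_max_right _ _)
  have h := S.le_mul_norm_add (R := R) (c := 1 + ε) (L := L) (S.ul_contDiffOn R)
    (fun y hy => S.hulconv y hy.2) (fun y hy => by
      rcases hy with hy | hy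
      · rw [mem_sphere_zero_iff_norm] at hy
        have h1 := hC y fun hyK =>
          S.notMem_K_of_le_norm (hR0.trans hy.ge) (interior_subset hyK)
        have h2 := (abs_le.1 h1).2
        rw [hy] at h2 ⊢
        linarith
      · have h1 := hL y hy
        rw [← S.hulbc y hy] at h1
        nlinarith [norm_nonneg y]) x ⟨mem_closedBall_zero_iff.2 hRx, hx⟩
  have h2 : ε * ‖x‖ ≤ η := by
    rw [hε, div_mul_eq_mul_div, div_le_iff₀ (by positivity)]
    nlinarith [norm_nonneg x]
  linarith

/-- A transversal direction at a boundary point of `K`, pointing out of `K`. -/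
theorem exists_transversal {x₀ : Euc n} (hx₀ : x₀ ∈ frontier S.K) :
    ∃ (ν : Euc n) (r : ℝ), 0 < r ∧
      (∀ x ∈ ball x₀ r, x ∉ interior S.K → ∀ s ∈ Ioo 0 r, x + s • ν ∉ S.K) ∧
      ∀ s ∈ Ioo 0 r, x₀ - s • ν ∈ interior S.K := by
  obtain ⟨g, hg, hKg, hdg⟩ := S.hKsm
  obtain ⟨ν, hν⟩ : ∃ ν, 0 < fderiv ℝ g x₀ ν := by
    obtain ⟨v, hv⟩ := DFunLike.ne_iff.1 (hdg x₀ hx₀)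
    rcases lt_or_gt_of_ne hv with h | h
    · exact ⟨-v, by simpa using h⟩
    · exact ⟨v, h⟩
  have hν0 : 0 < ‖ν‖ := norm_pos_iff.2 fun h => by simp [h] at hν
  have hint : ∀ x, g x < 0 → x ∈ interior S.K := fun x hx => by
    refine mem_interior.2 ⟨{x | g x < 0}, fun y hy => ?_, isOpen_lt hg.continuous
      continuous_const, hx⟩
    have hy' : g y < 0 := hy
    rw [hKg]
    exact hy'.le
  have hstrict : HasStrictFDerivAt g (fderiv ℝ g x₀) x₀ :=
    hg.contDiffAt.hasStrictFDerivAt (by simp)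
  have hc0 : 0 < fderiv ℝ g x₀ ν / (2 * ‖ν‖) := by positivity
  have hlo := hstrict.isLittleO.def hc0
  obtain ⟨δ, hδ, hball⟩ := Metric.eventually_nhds_iff_ball.1 hlo
  have hmono : ∀ x ∈ ball x₀ δ, ∀ s : ℝ, 0 < s → x + s • ν ∈ ball x₀ δ → g x < g (x + s • ν) := by
    intro x hx s hs hxs
    have h1 := hball (x + s • ν, x) (by
      rw [← ball_prod_same]
      exact ⟨hxs, hx⟩)
    simp only [add_sub_cancel_left, map_smul, smul_eq_mul, norm_smul, Real.norm_of_nonneg hs.le]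
      at h1
    have h2 : fderiv ℝ g x₀ ν / (2 * ‖ν‖) * (s * ‖ν‖) = s * fderiv ℝ g x₀ ν / 2 := by
      field_simp
    rw [h2] at h1
    have h3 := (abs_le.1 h1).1
    nlinarith [mul_pos hs hν]
  refine ⟨ν, δ / 2 / (1 + ‖ν‖), by positivity, fun x hx hxK s hs hxs => ?_, fun s hs => ?_⟩
  · have hr : δ / 2 / (1 + ‖ν‖) ≤ δ / 2 := div_le_self (by positivity) (by linarith)
    have hx' : ‖x - x₀‖ < δ / 2 := (mem_ball_iff_norm.1 hx).trans_le hr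
    have hs' : s * ‖ν‖ < δ / 2 := by
      have := (lt_div_iff₀ (by positivity)).1 hs.2
      nlinarith [hs.1]
    have h1 : x + s • ν ∈ ball x₀ δ := by
      rw [mem_ball_iff_norm, add_sub_right_comm]
      refine (norm_add_le _ _).trans_lt ?_
      rw [norm_smul, Real.norm_of_nonneg hs.1.le]
      linarith
    have h2 := hmono x (mem_ball_iff_norm.2 (by linarith)) s hs.1 h1
    have h3 : 0 ≤ g x := not_lt.1 fun h => hxK (hint x h)
    rw [hKg] at hxs
    have h4 : g (x + s • ν) ≤ 0 := hxs
    linarith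
  · have hs' : s * ‖ν‖ < δ / 2 := by
      have := (lt_div_iff₀ (by positivity)).1 hs.2
      nlinarith [hs.1]
    have h1 : x₀ - s • ν ∈ ball x₀ δ := by
      rw [mem_ball_iff_norm, sub_sub_cancel_left, norm_neg, norm_smul,
        Real.norm_of_nonneg hs.1.le]
      linarith
    have h2 := hmono _ h1 s hs.1 (by simpa using hδ)
    rw [sub_add_cancel] at h2
    have h3 : x₀ ∈ S.K := S.hKc.isClosed.frontier_subset hx₀
    rw [hKg] at h3
    exact hint _ (h2.trans_le h3)

end ExtSetting

namespace IsSol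

variable {n : ℕ} {S : ExtSetting n} {R : ℝ} {u : Euc n → ℝ}

theorem contDiffOn (h : IsSol S R u) : ContDiffOn ℝ 2 u (solDom S R) := h.1.of_le two_le_natTop

theorem ul_le (h : IsSol S R u) : ∀ x ∈ solDom S R, S.ul x ≤ u x := by
  refine S.comparison h.contDiffOn (S.ul_contDiffOn R) h.2.1 (fun x hx => S.hulconv x hx.2)
    (fun x hx hlt => ?_) (fun x hx => (h.2.2.2 x hx).ge)
  rw [h.2.2.1 x hx]
  exact (S.hfz x (fun hK => hx.2 (interior_subset hK)) hlt.le).trans (S.hulsub x hx.2)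

theorem le_norm_add (h : IsSol S R u) {L : ℝ}
    (hL : ∀ x ∈ frontier S.K, S.u₀ x - ‖x‖ < L) (hR : S.R₀ ≤ R) :
    ∀ x ∈ solDom S R, u x ≤ ‖x‖ + L := by
  have h1 := S.le_mul_norm_add (c := 1) (L := L) h.contDiffOn h.2.1 fun x hx => by
    rw [h.2.2.2 x hx, one_mul]
    refine S.ul_le_norm_add hL x ?_
    rcases hx with hx | hx
    · rw [mem_sphere_zero_iff_norm] at hx
      exact fun hK => S.notMem_K_of_le_norm (hR.trans hx.ge) (interior_subset hK)
    · exact hx.2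
  simpa using h1

theorem le_of_radius_le (h : IsSol S R u) {R' : ℝ} {u' : Euc n → ℝ}
    (h' : IsSol S R' u') (hR : S.R₀ ≤ R) (hRR' : R ≤ R') :
    ∀ x ∈ solDom S R, u x ≤ u' x := by
  have hsub : solDom S R ⊆ solDom S R' :=
    sdiff_subset_sdiff (closedBall_subset_closedBall hRR') subset_rfl
  have hsub' : ball 0 R \ S.K ⊆ ball 0 R' \ S.K :=
    sdiff_subset_sdiff (ball_subset_ball hRR') subset_rfl
  refine S.comparison (h'.contDiffOn.mono hsub) h.contDiffOn (fun x hx => h'.2.1 x (hsub' hx))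
    h.2.1 (fun x hx hlt => ?_) (fun x hx => ?_)
  · rw [h.2.2.1 x hx, h'.2.2.1 x (hsub' hx)]
    exact S.hfz x (fun hK => hx.2 (interior_subset hK)) hlt.le
  · rw [h.2.2.2 x hx]
    refine h'.ul_le x (hsub ?_)
    rcases hx with hx | hx
    · refine ⟨sphere_subset_closedBall hx, fun hK => ?_⟩
      rw [mem_sphere_zero_iff_norm] at hx
      exact S.notMem_K_of_le_norm (hR.trans hx.ge) (interior_subset hK)
    · refine ⟨?_, hx.2⟩
      exact closedBall_subset_closedBall hR
        (ball_subset_closedBall (S.hKR₀ (S.hKc.isClosed.frontier_subset hx)))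

theorem le_chord (h : IsSol S R u) {x d : Euc n} (hR : ‖x‖ + ‖d‖ < R)
    (h01 : ∀ t ∈ Icc (0 : ℝ) 1, x + t • d ∉ interior S.K)
    (hoo : ∀ t ∈ Ioo (0 : ℝ) 1, x + t • d ∉ S.K) :
    ∀ t ∈ Icc (0 : ℝ) 1, u (x + t • d) ≤ (1 - t) * u x + t * u (x + d) := by
  have hball : ∀ t ∈ Icc (0 : ℝ) 1, x + t • d ∈ ball (0 : Euc n) R := fun t ht => by
    rw [mem_ball_zero_iff]
    refine (norm_add_le _ _).trans_lt ?_
    rw [norm_smul, Real.norm_of_nonneg ht.1]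
    nlinarith [norm_nonneg d, ht.2]
  have hcont : ContinuousOn (fun t : ℝ => u (x + t • d)) (Icc 0 1) :=
    h.contDiffOn.continuousOn.comp (by fun_prop)
      fun t ht => ⟨ball_subset_closedBall (hball t ht), h01 t ht⟩
  have hmem : ∀ t ∈ Ioo (0 : ℝ) 1, x + t • d ∈ ball (0 : Euc n) R \ S.K := fun t ht =>
    ⟨hball t (Ioo_subset_Icc_self ht), hoo t ht⟩
  have hconv := convexOn_line_of_Hess_posSemidef hcont
    (fun t ht => h.contDiffOn.contDiffAt (S.solDom_mem_nhds (hmem t ht)))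
    (fun t ht => (h.2.1 _ (hmem t ht)).posSemidef)
  intro t ht
  simpa using hconv.2 (left_mem_Icc.2 zero_le_one) (right_mem_Icc.2 zero_le_one)
    (sub_nonneg.2 ht.2) ht.1 (sub_add_cancel 1 t)

end IsSol

namespace ExtSetting

variable {n : ℕ} (S : ExtSetting n) {v : Euc n → ℝ} {L : ℝ}

/-- Moving from the complement of `int K` into `int K`, one meets the boundary of `K`. -/
theorem exists_mem_frontier {x ν : Euc n} {σ : ℝ} (hσ : 0 ≤ σ) (hx : x ∉ interior S.K)
    (hxσ : x - σ • ν ∈ interior S.K) : ∃ s ∈ Ico 0 σ, x - s • ν ∈ frontier S.K := by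
  have hcont : Continuous fun s : ℝ => x - s • ν := by fun_prop
  have hT : IsCompact (Icc 0 σ ∩ (fun s : ℝ => x - s • ν) ⁻¹' (interior S.K)ᶜ) :=
    isCompact_Icc.inter_right (isOpen_interior.isClosed_compl.preimage hcont)
  obtain ⟨s, ⟨hs, hsK⟩, hgreatest⟩ := hT.exists_isGreatest ⟨0, ⟨le_rfl, hσ⟩, by simpa using hx⟩
  have hsσ : s < σ := hs.2.lt_of_ne fun h => hsK (by subst h; exact hxσ)
  refine ⟨s, ⟨hs.1, hsσ⟩, S.mem_frontier ?_ hsK⟩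
  refine S.hKc.isClosed.mem_of_tendsto ((hcont.tendsto s).mono_left nhdsWithin_le_nhds)
    (b := 𝓝[>] s) ?_
  filter_upwards [Ioo_mem_nhdsGT hsσ] with t ht
  by_contra htK
  exact ht.1.not_ge (hgreatest ⟨⟨hs.1.trans ht.1.le, ht.2.le⟩, fun h => htK (interior_subset h)⟩)

/-- Convexity along segments whose relative interior avoids `K`. -/
def ConvexOff (v : Euc n → ℝ) : Prop :=
  ∀ x d : Euc n, (∀ t ∈ Icc (0 : ℝ) 1, x + t • d ∉ interior S.K) →
    (∀ t ∈ Ioo (0 : ℝ) 1, x + t • d ∉ S.K) →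
    ∀ t ∈ Icc (0 : ℝ) 1, v (x + t • d) ≤ (1 - t) * v x + t * v (x + d)

variable {S}

theorem ConvexOff.continuousAt (hv : S.ConvexOff v) {x₀ : Euc n} (hx₀ : x₀ ∉ S.K) :
    ContinuousAt v x₀ := by
  obtain ⟨ρ, hρ, hball⟩ := Metric.isOpen_iff.1 S.hKc.isClosed.isOpen_compl x₀ hx₀
  have hconv : ConvexOn ℝ (ball x₀ ρ) v := by
    refine ⟨convex_ball x₀ ρ, fun x hx y hy a b ha hb hab => ?_⟩
    have hmem : ∀ t ∈ Icc (0 : ℝ) 1, x + t • (y - x) ∉ S.K := fun t ht =>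
      hball ((convex_ball x₀ ρ).add_smul_sub_mem hx hy ht)
    have h1 := hv x (y - x) (fun t ht h => hmem t ht (interior_subset h))
      (fun t ht => hmem t (Ioo_subset_Icc_self ht)) b ⟨hb, by linarith⟩
    have ha' : a = 1 - b := by linarith
    have h2 : a • x + b • y = x + b • (y - x) := by
      rw [ha']
      module
    rw [h2, smul_eq_mul, smul_eq_mul, ha']
    simpa using h1
  exact (hconv.continuousOn isOpen_ball).continuousAt (isOpen_ball.mem_nhds (mem_ball_self hρ))

theorem ConvexOff.continuousWithinAt_frontier (hv : S.ConvexOff v)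
    (hlow : ∀ x ∈ (interior S.K)ᶜ, S.ul x ≤ v x) (hup : ∀ x ∈ (interior S.K)ᶜ, v x ≤ ‖x‖ + L)
    (hfr : ∀ x ∈ frontier S.K, v x = S.ul x) {x₀ : Euc n} (hx₀ : x₀ ∈ frontier S.K) :
    ContinuousWithinAt v (interior S.K)ᶜ x₀ := by
  obtain ⟨ν, r, hr, hout, hin⟩ := S.exists_transversal hx₀
  have hul : ContinuousWithinAt S.ul (interior S.K)ᶜ x₀ := S.hulsm.continuousOn x₀ hx₀.2
  rw [Metric.continuousWithinAt_iff'] at hul ⊢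
  intro η hη
  obtain ⟨δ, hδ, hulδ⟩ := Metric.eventually_nhds_iff_ball.1
    (eventually_nhdsWithin_iff.1 (hul (η / 2) (half_pos hη)))
  set M : ℝ := ‖x₀‖ + r + r * ‖ν‖ + L with hM
  set A : ℝ := |M| + |S.ul x₀| + η with hA
  have hA0 : 0 < A := by positivity
  obtain ⟨σ, ⟨⟨hσr, hσν⟩, hσA⟩, hσ0⟩ : ∃ σ : ℝ, ((σ < r / 2 ∧ σ * ‖ν‖ < min r δ / 2) ∧
      σ / (r / 2) * A < η / 2) ∧ 0 < σ := by
    have h1 : ∀ᶠ σ in 𝓝 (0 : ℝ), σ < r / 2 := gt_mem_nhds (by positivity)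
    have h2 : ∀ᶠ σ in 𝓝 (0 : ℝ), σ * ‖ν‖ < min r δ / 2 :=
      (by fun_prop : Continuous fun σ : ℝ => σ * ‖ν‖).continuousAt.eventually_lt_const
        (by simp only [zero_mul]; positivity)
    have h3 : ∀ᶠ σ in 𝓝 (0 : ℝ), σ / (r / 2) * A < η / 2 :=
      (by fun_prop : Continuous fun σ : ℝ => σ / (r / 2) * A).continuousAt.eventually_lt_const
        (by simp only [zero_div, zero_mul]; positivity)
    exact ((((h1.and h2).and h3).filter_mono nhdsWithin_le_nhds).and
      (self_mem_nhdsWithin : Ioi (0 : ℝ) ∈ 𝓝[>] 0)).exists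
  have hnear : ∀ᶠ x in 𝓝 x₀, x ∈ ball x₀ (min r δ / 2) := ball_mem_nhds _ (by positivity)
  have hinto : ∀ᶠ x in 𝓝 x₀, x - σ • ν ∈ interior S.K :=
    (by fun_prop : Continuous fun x : Euc n => x - σ • ν).continuousAt.eventually_mem
      (isOpen_interior.mem_nhds (hin σ ⟨hσ0, by linarith⟩))
  filter_upwards [self_mem_nhdsWithin, nhdsWithin_le_nhds hnear, nhdsWithin_le_nhds hinto]
    with x hxK hxb hxσ
  obtain ⟨s, hs, hsfr⟩ := S.exists_mem_frontier hσ0.le hxK hxσ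
  set y := x - s • ν with hy
  have hyb : ‖y - x₀‖ < min r δ := by
    have h1 : y - x₀ = (x - x₀) - s • ν := by rw [hy]; module
    have h2 := norm_sub_le (x - x₀) (s • ν)
    rw [norm_smul, Real.norm_of_nonneg hs.1] at h2
    have h3 : s * ‖ν‖ ≤ σ * ‖ν‖ := by gcongr; exact hs.2.le
    rw [mem_ball_iff_norm] at hxb
    rw [h1]
    linarith
  have hyr : y ∈ ball x₀ r := mem_ball_iff_norm.2 (hyb.trans_le (min_le_left _ _))
  have huly : |S.ul y - S.ul x₀| < η / 2 :=
    hulδ y (mem_ball_iff_norm.2 (hyb.trans_le (min_le_right _ _))) hsfr.2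
  have hulx : |S.ul x - S.ul x₀| < η / 2 := by
    refine hulδ x ?_ hxK
    rw [mem_ball_iff_norm] at hxb ⊢
    have := min_le_right r δ
    linarith
  have houty : ∀ t ∈ Ioc (0 : ℝ) 1, y + t • (r / 2) • ν ∉ S.K := fun t ht => by
    rw [smul_smul]
    exact hout y hyr hsfr.2 _ ⟨mul_pos ht.1 (by positivity), by nlinarith [ht.2]⟩
  have hθ : s / (r / 2) ∈ Icc (0 : ℝ) 1 :=
    ⟨div_nonneg hs.1 (by positivity), (div_le_one (by positivity)).2 (hs.2.trans hσr).le⟩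
  have hchord := hv y ((r / 2) • ν) (fun t ht => by
      rcases ht.1.eq_or_lt with h | h
      · rw [← h, zero_smul, add_zero]
        exact hsfr.2
      · exact fun hK => houty t ⟨h, ht.2⟩ (interior_subset hK))
    (fun t ht => houty t (Ioo_subset_Ioc_self ht)) _ hθ
  have hx : y + (s / (r / 2)) • (r / 2) • ν = x := by
    rw [smul_smul, div_mul_cancel₀ _ (by positivity), hy, sub_add_cancel]
  have hz : v (y + (r / 2) • ν) ≤ M := by
    have hzK := houty 1 ⟨one_pos, le_rfl⟩
    rw [one_smul] at hzK
    refine (hup _ fun h => hzK (interior_subset h)).trans ?_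
    have h1 := norm_add_le y ((r / 2) • ν)
    have h2 := norm_le_norm_add_norm_sub' y x₀
    rw [norm_smul, Real.norm_of_nonneg (by positivity)] at h1
    rw [mem_ball_iff_norm] at hyr
    have h3 : 0 ≤ r * ‖ν‖ := by positivity
    rw [hM]
    linarith
  rw [hx, hfr y hsfr] at hchord
  have hθσ : s / (r / 2) * A ≤ σ / (r / 2) * A := by gcongr; exact hs.2.le
  have hMA : M - S.ul y ≤ A := by
    have h1 := le_abs_self M
    have h2 := neg_abs_le (S.ul x₀)
    have h3 := (abs_lt.1 huly).1
    rw [hA]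
    linarith
  have h1 : s / (r / 2) * (v (y + (r / 2) • ν) - S.ul y) ≤ s / (r / 2) * A :=
    mul_le_mul_of_nonneg_left (by linarith) hθ.1
  rw [Real.dist_eq, abs_lt, hfr x₀ hx₀]
  constructor
  · linarith [hlow x hxK, (abs_lt.1 hulx).1]
  · linarith [(abs_lt.1 huly).2]

theorem ConvexOff.continuousOn (hv : S.ConvexOff v)
    (hlow : ∀ x ∈ (interior S.K)ᶜ, S.ul x ≤ v x) (hup : ∀ x ∈ (interior S.K)ᶜ, v x ≤ ‖x‖ + L)
    (hfr : ∀ x ∈ frontier S.K, v x = S.ul x) : ContinuousOn v (interior S.K)ᶜ := by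
  intro x hx
  by_cases hxK : x ∈ S.K
  · exact hv.continuousWithinAt_frontier hlow hup hfr (S.mem_frontier hxK hx)
  · exact (hv.continuousAt hxK).continuousWithinAt

variable (S) in
theorem exists_shift {p : Euc n} (hp : p ∉ interior S.K) : ∃ (ν : Euc n) (r : ℝ), 0 < r ∧
    ∀ x ∈ ball p r, x ∉ interior S.K → ∀ s ∈ Ioo 0 r, x + s • ν ∉ S.K := by
  by_cases hpK : p ∈ S.K
  · obtain ⟨ν, r, hr, h, -⟩ := S.exists_transversal (S.mem_frontier hpK hp)
    exact ⟨ν, r, hr, h⟩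
  · obtain ⟨r, hr, h⟩ := Metric.isOpen_iff.1 S.hKc.isClosed.isOpen_compl p hpK
    exact ⟨0, r, hr, fun x hx _ s _ => by simpa using h hx⟩

/-- A continuous function which is convex off `K` is convex along all segments in the closure
of the exterior, including those touching `K`. -/
theorem ConvexOff.le_chord_of_segment (hv : S.ConvexOff v)
    (hvc : ContinuousOn v (interior S.K)ᶜ) {x d : Euc n}
    (hseg : ∀ t ∈ Icc (0 : ℝ) 1, x + t • d ∉ interior S.K) :
    ∀ t ∈ Icc (0 : ℝ) 1, v (x + t • d) ≤ (1 - t) * v x + t * v (x + d) := by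
  have hmain := le_chord_of_local_midpoint (h := fun t => v (x + t • d))
    (hvc.comp (by fun_prop) hseg) fun t ht => by
      obtain ⟨ν, r, hr, hout⟩ := S.exists_shift (hseg t (Ioo_subset_Icc_self ht))
      refine ⟨min (r / (‖d‖ + 1)) (min t (1 - t)),
        lt_min (by positivity) (lt_min ht.1 (sub_pos.2 ht.2)), fun δ hδ => ?_⟩
      obtain ⟨hδ0, hδlt⟩ := hδ
      obtain ⟨hδr, hδt, hδt'⟩ := by simpa only [lt_min_iff] using hδlt
      have hδd : δ * ‖d‖ < r := by
        have := (lt_div_iff₀ (by positivity)).1 hδr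
        linarith
      have hmem : ∀ τ ∈ Icc (t - δ) (t + δ), x + τ • d ∉ interior S.K := fun τ hτ =>
        hseg τ ⟨by linarith [hτ.1], by linarith [hτ.2]⟩
      have hshift : ∀ τ ∈ Icc (t - δ) (t + δ), ∀ s ∈ Ioo 0 r, x + τ • d + s • ν ∉ S.K := by
        intro τ hτ s hs
        refine hout _ ?_ (hmem τ hτ) s hs
        have h1 : x + τ • d - (x + t • d) = (τ - t) • d := by module
        have h2 : |τ - t| ≤ δ := abs_le.2 ⟨by linarith [hτ.1], by linarith [hτ.2]⟩
        rw [mem_ball_iff_norm, h1, norm_smul, Real.norm_eq_abs]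
        exact (mul_le_mul_of_nonneg_right h2 (norm_nonneg d)).trans_lt hδd
      have htends : ∀ τ ∈ Icc (t - δ) (t + δ),
          Tendsto (fun s : ℝ => v (x + τ • d + s • ν)) (𝓝[>] 0) (𝓝 (v (x + τ • d))) := by
        intro τ hτ
        refine (hvc _ (hmem τ hτ)).tendsto.comp (tendsto_nhdsWithin_iff.2 ⟨?_, ?_⟩)
        · have : Continuous fun s : ℝ => x + τ • d + s • ν := by fun_prop
          have h0 := (this.tendsto 0).mono_left (nhdsWithin_le_nhds (s := Ioi 0))
          rwa [zero_smul, add_zero] at h0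
        · filter_upwards [Ioo_mem_nhdsGT hr] with s hs hK
          exact hshift τ hτ s hs (interior_subset hK)
      refine le_of_tendsto_of_tendsto
        ((htends t ⟨by linarith, by linarith⟩).const_mul 2)
        ((htends (t - δ) ⟨le_rfl, by linarith⟩).add (htends (t + δ) ⟨by linarith, le_rfl⟩)) ?_
      filter_upwards [Ioo_mem_nhdsGT hr] with s hs
      have hline : ∀ k : ℝ, x + (t - δ) • d + s • ν + k • (2 * δ) • d
          = x + (t - δ + 2 * δ * k) • d + s • ν := fun k => by module
      have hK : ∀ k ∈ Icc (0 : ℝ) 1, x + (t - δ) • d + s • ν + k • (2 * δ) • d ∉ S.K :=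
        fun k hk => by
          rw [hline]
          exact hshift _ ⟨by nlinarith [hk.1], by nlinarith [hk.2]⟩ s hs
      have h1 := hv (x + (t - δ) • d + s • ν) ((2 * δ) • d)
        (fun k hk h => hK k hk (interior_subset h))
        (fun k hk => hK k (Ioo_subset_Icc_self hk)) (1 / 2) ⟨by norm_num, by norm_num⟩
      have h2 := hline 1
      rw [one_smul] at h2
      rw [hline, h2] at h1
      have h3 : t - δ + 2 * δ * (1 / 2) = t := by ring
      have h4 : t - δ + 2 * δ * 1 = t + δ := by ring
      rw [h3, h4] at h1
      change 2 * v (x + t • d + s • ν)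
        ≤ v (x + (t - δ) • d + s • ν) + v (x + (t + δ) • d + s • ν)
      linarith
  simpa using hmain

end ExtSetting

section Limit

variable {n : ℕ} {S : ExtSetting n} {u : ℝ → Euc n → ℝ} {v : Euc n → ℝ} {L : ℝ}

theorem ExtSetting.eventually_isSol_and_mem
    (hu : ∀ R : ℝ, 4 * S.R₀ < R → IsSol S R (u R)) {x : Euc n} (hx : x ∈ (interior S.K)ᶜ) :
    ∀ᶠ R in atTop, IsSol S R (u R) ∧ S.R₀ ≤ R ∧ x ∈ solDom S R := by
  filter_upwards [eventually_gt_atTop (4 * S.R₀), eventually_ge_atTop ‖x‖] with R hR hxR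
  exact ⟨hu R hR, by linarith [S.hR₀], mem_closedBall_zero_iff.2 hxR, hx⟩

theorem ExtSetting.exists_tendsto (hL : ∀ x ∈ frontier S.K, S.u₀ x - ‖x‖ < L)
    (hu : ∀ R : ℝ, 4 * S.R₀ < R → IsSol S R (u R)) :
    ∃ v : Euc n → ℝ, ∀ x ∈ (interior S.K)ᶜ, Tendsto (fun R => u R x) atTop (𝓝 (v x)) := by
  have hpt : ∀ x, ∃ l, x ∈ (interior S.K)ᶜ → Tendsto (fun R => u R x) atTop (𝓝 l) := by
    intro x
    by_cases hx : x ∈ (interior S.K)ᶜ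
    · obtain ⟨R₁, hR₁⟩ := eventually_atTop.1 (S.eventually_isSol_and_mem hu hx)
      have hmono : Monotone fun R => u (max R R₁) x := fun R R' hRR' => by
        obtain ⟨h1, h2, h3⟩ := hR₁ _ (le_max_right R R₁)
        exact h1.le_of_radius_le (hR₁ _ (le_max_right R' R₁)).1 h2
          (max_le_max_right R₁ hRR') x h3
      have hbdd : BddAbove (range fun R => u (max R R₁) x) := by
        refine ⟨‖x‖ + L, ?_⟩
        rintro _ ⟨R, rfl⟩
        obtain ⟨h1, h2, h3⟩ := hR₁ _ (le_max_right R R₁)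
        exact h1.le_norm_add hL h2 x h3
      refine ⟨_, fun _ => (tendsto_atTop_ciSup hmono hbdd).congr' ?_⟩
      filter_upwards [eventually_ge_atTop R₁] with R hR
      rw [max_eq_left hR]
    · exact ⟨0, fun h => absurd h hx⟩
  choose v hv using hpt
  exact ⟨v, hv⟩

theorem ExtSetting.le_limit
    (hu : ∀ R : ℝ, 4 * S.R₀ < R → IsSol S R (u R))
    (hv : ∀ x ∈ (interior S.K)ᶜ, Tendsto (fun R => u R x) atTop (𝓝 (v x)))
    {R : ℝ} (hR : 4 * S.R₀ < R) {x : Euc n} (hx : x ∈ solDom S R) :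
    u R x ≤ v x := by
  refine ge_of_tendsto (hv x hx.2) ?_
  filter_upwards [eventually_ge_atTop R] with R' hR'
  exact (hu R hR).le_of_radius_le (hu R' (hR.trans_le hR')) (by linarith [S.hR₀]) hR' x hx

theorem ExtSetting.convexOff_limit
    (hu : ∀ R : ℝ, 4 * S.R₀ < R → IsSol S R (u R))
    (hv : ∀ x ∈ (interior S.K)ᶜ, Tendsto (fun R => u R x) atTop (𝓝 (v x))) :
    S.ConvexOff v := by
  intro x d h01 hoo t ht
  have hx : x ∈ (interior S.K)ᶜ := by simpa using h01 0 (by simp)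
  have hxd : x + d ∈ (interior S.K)ᶜ := by simpa using h01 1 (by simp)
  refine le_of_tendsto_of_tendsto (hv _ (h01 t ht))
    (((hv x hx).const_mul (1 - t)).add ((hv _ hxd).const_mul t)) ?_
  filter_upwards [eventually_gt_atTop (4 * S.R₀), eventually_gt_atTop (‖x‖ + ‖d‖)] with R hR hR'
  exact (hu R hR).le_chord hR' h01 hoo t ht

theorem ExtSetting.continuousOn_limit
    (hu : ∀ R : ℝ, 4 * S.R₀ < R → IsSol S R (u R))
    (hv : ∀ x ∈ (interior S.K)ᶜ, Tendsto (fun R => u R x) atTop (𝓝 (v x)))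
    (hL : ∀ x ∈ frontier S.K, S.u₀ x - ‖x‖ < L) :
    ContinuousOn v (interior S.K)ᶜ := by
  refine (ExtSetting.convexOff_limit hu hv).continuousOn (L := L) (fun x hx => ?_)
    (fun x hx => ?_) (fun x hx => ?_)
  · exact ge_of_tendsto (hv x hx) ((S.eventually_isSol_and_mem hu hx).mono
      fun R h => h.1.ul_le x h.2.2)
  · exact le_of_tendsto (hv x hx) ((S.eventually_isSol_and_mem hu hx).mono
      fun R h => h.1.le_norm_add hL h.2.1 x h.2.2)
  · refine tendsto_nhds_unique (hv x hx.2) (tendsto_const_nhds.congr' ?_)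
    filter_upwards [S.eventually_isSol_and_mem hu hx.2] with R h
    exact (h.1.2.2.2 x (.inr hx)).symm

theorem ExtSetting.tendstoLocallyUniformlyOn_limit
    (hu : ∀ R : ℝ, 4 * S.R₀ < R → IsSol S R (u R))
    (hv : ∀ x ∈ (interior S.K)ᶜ, Tendsto (fun R => u R x) atTop (𝓝 (v x)))
    (hvc : ContinuousOn v (interior S.K)ᶜ) :
    TendstoLocallyUniformlyOn u v atTop (interior S.K)ᶜ := by
  rw [Metric.tendstoLocallyUniformlyOn_iff]
  intro ε hε x hx
  obtain ⟨R, hRx, hR, hxR⟩ := ((hv x hx).eventually_const_lt (sub_lt_self (v x) hε)).and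
    ((eventually_gt_atTop (4 * S.R₀)).and (eventually_gt_atTop ‖x‖)) |>.exists
  have hball : ball (0 : Euc n) R ∈ 𝓝 x := isOpen_ball.mem_nhds (mem_ball_zero_iff.2 hxR)
  have huc : ContinuousWithinAt (u R) (interior S.K)ᶜ x := by
    refine ((hu R hR).contDiffOn.continuousOn x
      ⟨mem_closedBall_zero_iff.2 hxR.le, hx⟩).mono_of_mem_nhdsWithin ?_
    filter_upwards [self_mem_nhdsWithin, nhdsWithin_le_nhds hball] with y hy hyR
    exact ⟨ball_subset_closedBall hyR, hy⟩
  have hev : ∀ᶠ y in 𝓝[(interior S.K)ᶜ] x, v y - u R y < ε :=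
    ((hvc x hx).sub huc).tendsto.eventually_lt_const (by simp only [Pi.sub_apply]; linarith)
  refine ⟨{y | v y - u R y < ε} ∩ (ball 0 R ∩ (interior S.K)ᶜ),
    inter_mem hev (inter_mem (nhdsWithin_le_nhds hball) self_mem_nhdsWithin), ?_⟩
  filter_upwards [eventually_ge_atTop R] with R' hR' y hy
  obtain ⟨hyε, hyR, hyK⟩ := hy
  have hyε : v y - u R y < ε := hyε
  have hyD : y ∈ solDom S R := ⟨ball_subset_closedBall hyR, hyK⟩
  have h1 : u R y ≤ u R' y := (hu R hR).le_of_radius_le (hu R' (hR.trans_le hR'))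
    (by linarith [S.hR₀]) hR' y hyD
  have h2 : u R' y ≤ v y := ExtSetting.le_limit hu hv (hR.trans_le hR')
    ⟨closedBall_subset_closedBall hR' hyD.1, hyK⟩
  rw [Real.dist_eq, abs_of_nonneg (sub_nonneg.2 h2)]
  linarith

end Limit

end Auxiliary

theorem barriers_monotonicity_convergence
    (n : ℕ) (S : ExtSetting n) (L : ℝ)
    (hL : ∀ x ∈ frontier S.K, S.u₀ x - ‖x‖ < L)
    (u : ℝ → Euc n → ℝ) (hu : ∀ R : ℝ, 4 * S.R₀ < R → IsSol S R (u R)) :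
    (∀ R : ℝ, 4 * S.R₀ < R → ∀ x ∈ solDom S R, S.ul x ≤ u R x ∧ u R x ≤ ‖x‖ + L) ∧
    (∀ R₁ R₂ : ℝ, 4 * S.R₀ < R₁ → R₁ < R₂ → ∀ x ∈ solDom S R₁, u R₁ x ≤ u R₂ x) ∧
    (∃ v : Euc n → ℝ, ContinuousOn v (interior S.K)ᶜ ∧
      (∀ x ∈ (interior S.K)ᶜ, ∀ y ∈ (interior S.K)ᶜ, ∀ a b : ℝ, 0 ≤ a → 0 ≤ b →
        a + b = 1 → segment ℝ x y ⊆ (interior S.K)ᶜ →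
        v (a • x + b • y) ≤ a * v x + b * v y) ∧
      TendstoLocallyUniformlyOn u v atTop (interior S.K)ᶜ) := by
  refine ⟨fun R hR x hx => ⟨(hu R hR).ul_le x hx,
      (hu R hR).le_norm_add hL (by linarith [S.hR₀]) x hx⟩,
    fun R₁ R₂ hR₁ hR₁₂ => (hu R₁ hR₁).le_of_radius_le (hu R₂ (hR₁.trans hR₁₂))
      (by linarith [S.hR₀]) hR₁₂.le, ?_⟩
  obtain ⟨v, hv⟩ := ExtSetting.exists_tendsto hL hu
  have hvc := ExtSetting.continuousOn_limit hu hv hL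
  refine ⟨v, hvc, fun x _ y _ a b ha hb hab hseg => ?_,
    ExtSetting.tendstoLocallyUniformlyOn_limit hu hv hvc⟩
  have hmem : ∀ t ∈ Icc (0 : ℝ) 1, x + t • (y - x) ∉ interior S.K := fun t ht =>
    hseg (segment_eq_image' ℝ x y ▸ mem_image_of_mem _ ht)
  have h1 := (ExtSetting.convexOff_limit hu hv).le_chord_of_segment hvc hmem b ⟨hb, by linarith⟩
  have ha' : a = 1 - b := by linarith
  have h2 : a • x + b • y = x + b • (y - x) := by
    rw [ha']
    module
  rw [h2, ha']
  simpa using h1
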